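/- Let n ≥ 2. If 𝒜 satisfies (H) for (i,j), ℬ satisfies (H) for (k,l), and 𝒞 is any set of disjoint self-avoiding curves, then the convolution product is associative: (𝒜∗ℬ)∗𝒞 = 𝒜∗(ℬ∗𝒞). -/

import Mathlib

namespace Folding

noncomputable section

open Set

/-- Points of `ℝ^n` with the euclidean distance. -/
abbrev Pt (n : ℕ) := EuclideanSpace ℝ (Fin n)

/-- `p` is a point of the lattice `ℤ^n`. -/
def latt {n : ℕ} (p : Pt n) : Prop := ∀ i, ∃ m : ℤ, p i = (m : ℝ)

/-- `p` belongs to `m·ℤ^n`. -/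
def inLat {n : ℕ} (m : ℕ) (p : Pt n) : Prop := ∀ i, ∃ c : ℤ, p i = (m : ℝ) * (c : ℝ)

/-- The canonical basis vector `e_i`. -/
def uvec (n : ℕ) (i : Fin n) : Pt n := EuclideanSpace.single i (1 : ℝ)

/-- `u` belongs to `E = {e_1, -e_1, …, e_n, -e_n}`. -/
def IsDir {n : ℕ} (u : Pt n) : Prop := ∃ i, u = uvec n i ∨ u = -uvec n i

/-- A (nonoriented) lattice segment `[x, x + e_i]`, as an unordered pair of endpoints. -/
def IsSeg {n : ℕ} (S : Sym2 (Pt n)) : Prop := ∃ x i, latt x ∧ S = s(x, x + uvec n i)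

/-- A curve: a sequence of segments, indexed by an interval of `ℤ` (finite, ℕ-like or ℤ-like),
recorded through its sequence of vertices; two consecutive segments have exactly one common
endpoint, and the common endpoints with the preceding and the following segments differ
(`noback`). -/
structure Curve (n : ℕ) where
  dom : Set ℤ
  ordConn : dom.OrdConnected
  nontriv : ∃ i, i ∈ dom ∧ i + 1 ∈ dom
  v : ℤ → Pt n
  lattice : ∀ i ∈ dom, latt (v i)
  step : ∀ i : ℤ, i ∈ dom → i + 1 ∈ dom →
    ∃ j, v (i + 1) = v i + uvec n j ∨ v (i + 1) = v i - uvec n j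
  noback : ∀ i : ℤ, i - 1 ∈ dom → i + 1 ∈ dom → v (i + 1) ≠ v (i - 1)

namespace Curve

variable {n : ℕ} (c : Curve n)

/-- The segments of a curve. -/
def segs : Set (Sym2 (Pt n)) :=
  {S | ∃ i : ℤ, i ∈ c.dom ∧ i + 1 ∈ c.dom ∧ S = s(c.v i, c.v (i + 1))}

/-- The connexions between segments of a curve: pairs of consecutive segments. -/
def conn (S T : Sym2 (Pt n)) : Prop :=
  ∃ i : ℤ, i - 1 ∈ c.dom ∧ i + 1 ∈ c.dom ∧
    ((S = s(c.v (i - 1), c.v i) ∧ T = s(c.v i, c.v (i + 1))) ∨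
     (T = s(c.v (i - 1), c.v i) ∧ S = s(c.v i, c.v (i + 1))))

/-- A curve is self-avoiding if each of its segments appears only once. -/
def SelfAvoiding : Prop :=
  ∀ i j : ℤ, i ∈ c.dom → i + 1 ∈ c.dom → j ∈ c.dom → j + 1 ∈ c.dom →
    s(c.v i, c.v (i + 1)) = s(c.v j, c.v (j + 1)) → i = j

/-- A curve without endpoints (indexed by `ℤ`). -/
def NoEndpts : Prop := c.dom = Set.univ

/-- `p` is an endpoint of the curve `c`. -/
def IsEndpt (p : Pt n) : Prop :=
  ∃ i ∈ c.dom, p = c.v i ∧ (i - 1 ∉ c.dom ∨ i + 1 ∉ c.dom)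

/-- `S` is the end segment of `c` at its endpoint `p`. -/
def endSegAt (p : Pt n) (S : Sym2 (Pt n)) : Prop :=
  ∃ i : ℤ, i ∈ c.dom ∧ p = c.v i ∧
    ((i - 1 ∉ c.dom ∧ i + 1 ∈ c.dom ∧ S = s(c.v i, c.v (i + 1))) ∨
     (i + 1 ∉ c.dom ∧ i - 1 ∈ c.dom ∧ S = s(c.v (i - 1), c.v i)))

/-- The number of segments (length) of a curve. -/
def nsegs : ℕ := {i : ℤ | i ∈ c.dom ∧ i + 1 ∈ c.dom}.ncard

end Curve

/-- The trace of a set of curves: its set of segments together with the connexion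
relation between segments.  Two sets of curves are geometrically the same set of
(nonoriented) curves iff they have the same trace. -/
structure Trace (n : ℕ) where
  segs : Set (Sym2 (Pt n))
  conn : Sym2 (Pt n) → Sym2 (Pt n) → Prop

def curveTrace {n : ℕ} (c : Curve n) : Trace n := ⟨c.segs, c.conn⟩

def traceOf {n : ℕ} (E : Set (Curve n)) : Trace n :=
  ⟨{S | ∃ c ∈ E, S ∈ c.segs}, fun S T => ∃ c ∈ E, c.conn S T⟩

/-- Two curves are the same nonoriented curve. -/
def SameCurve {n : ℕ} (c d : Curve n) : Prop := c.segs = d.segs ∧ c.conn = d.conn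

/-- A set of pairwise disjoint self-avoiding curves. -/
def DisjSA {n : ℕ} (E : Set (Curve n)) : Prop :=
  (∀ c ∈ E, c.SelfAvoiding) ∧
  ∀ c ∈ E, ∀ d ∈ E, ¬ SameCurve c d → ∀ S, S ∈ c.segs → S ∉ d.segs

/-- The set of points of `ℝ^n` lying on the segment `S`. -/
def segPts {n : ℕ} (S : Sym2 (Pt n)) : Set (Pt n) :=
  {p | ∃ a b, S = s(a, b) ∧ ∃ t : ℝ, 0 ≤ t ∧ t ≤ 1 ∧ p = a + t • (b - a)}

def Trace.pts {n : ℕ} (T : Trace n) : Set (Pt n) := ⋃ S ∈ T.segs, segPts S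

/-- A set of curves covers `X ⊆ ℝ^n`: each lattice segment containing a point of `X`
appears in one and only one of the curves. -/
def Covers {n : ℕ} (E : Set (Curve n)) (X : Set (Pt n)) : Prop :=
  ∀ S, IsSeg S → (segPts S ∩ X).Nonempty →
    (∃ c ∈ E, S ∈ c.segs) ∧ ∀ c ∈ E, ∀ d ∈ E, S ∈ c.segs → S ∈ d.segs → SameCurve c d

/-- A covering of `ℝ^n` by disjoint self-avoiding curves. -/
def IsCovering {n : ℕ} (E : Set (Curve n)) : Prop := DisjSA E ∧ Covers E Set.univ

/-- A single curve covers `X`. -/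
def CurveCovers {n : ℕ} (c : Curve n) (X : Set (Pt n)) : Prop :=
  ∀ S, IsSeg S → (segPts S ∩ X).Nonempty → S ∈ c.segs

/-- `b` is a curve contained in the curve `a`. -/
def SubCurve {n : ℕ} (b a : Curve n) : Prop :=
  b.segs ⊆ a.segs ∧ ∀ S T, b.conn S T → a.conn S T

/-- The relation `≺` at the level of traces. -/
def TPrec {n : ℕ} (T T' : Trace n) : Prop :=
  T.segs ⊆ T'.segs ∧ ∀ S S', T.conn S S' → T'.conn S S'

/-- `E ≺ F` : each segment of a curve of `E` is a segment of a curve of `F` and each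
connexion between two segments of a curve of `E` also exists in `F`. -/
def Prec {n : ℕ} (E F : Set (Curve n)) : Prop := TPrec (traceOf E) (traceOf F)

/-- Image of a trace under a map of `ℝ^n`. -/
def Trace.map {n : ℕ} (f : Pt n → Pt n) (T : Trace n) : Trace n :=
  ⟨Sym2.map f '' T.segs,
   fun S S' => ∃ A B, T.conn A B ∧ S = Sym2.map f A ∧ S' = Sym2.map f B⟩

/-- Translation of a trace by the vector `t`. -/
def Trace.transl {n : ℕ} (t : Pt n) (T : Trace n) : Trace n := T.map (fun p => p + t)

/-- Property (H) for the pair `(k, l)`. -/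
def SatH {n : ℕ} (A : Set (Curve n)) (k l : ℕ) : Prop :=
  0 < k ∧ 0 < l ∧ k ∣ l ∧ IsCovering A ∧
  (∀ c ∈ A, c.dom.Finite ∧ ∃ x i, latt x ∧ inLat k x ∧ c.IsEndpt x ∧
      c.IsEndpt (x + (k : ℝ) • uvec n i) ∧
      ∀ p, c.IsEndpt p → p = x ∨ p = x + (k : ℝ) • uvec n i) ∧
  (∀ (x : Pt n) (i : Fin n), latt x → inLat k x →
      (∃ c ∈ A, c.IsEndpt x ∧ c.IsEndpt (x + (k : ℝ) • uvec n i)) ∧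
      ∀ c ∈ A, ∀ d ∈ A, c.IsEndpt x → c.IsEndpt (x + (k : ℝ) • uvec n i) →
        d.IsEndpt x → d.IsEndpt (x + (k : ℝ) • uvec n i) → SameCurve c d) ∧
  (∀ t : Pt n, inLat l t → Trace.transl t (traceOf A) = traceOf A)

/-- The trace of the convolution product `A ∗ B`, where `A` satisfies (H) for `(k, l)`:
apply to `B` the homothety of center `0` and ratio `k`, then replace each resulting
segment by the curve of `A` having the same endpoints (connexions come from the curves
of `A`, together with the junctions of the end segments of consecutive `A`-curves). -/
def ConvTrace {n : ℕ} (k : ℕ) (A B : Set (Curve n)) : Trace n where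
  segs := {S | ∃ a b : Pt n, s(a, b) ∈ (traceOf B).segs ∧
    ∃ c ∈ A, c.IsEndpt ((k : ℝ) • a) ∧ c.IsEndpt ((k : ℝ) • b) ∧ S ∈ c.segs}
  conn := fun S S' =>
    (∃ a b : Pt n, s(a, b) ∈ (traceOf B).segs ∧
      ∃ c ∈ A, c.IsEndpt ((k : ℝ) • a) ∧ c.IsEndpt ((k : ℝ) • b) ∧ c.conn S S') ∨
    (∃ a b d : Pt n, (traceOf B).conn s(a, b) s(b, d) ∧
      ∃ c ∈ A, ∃ c' ∈ A, c.IsEndpt ((k : ℝ) • a) ∧ c.IsEndpt ((k : ℝ) • b) ∧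
        c'.IsEndpt ((k : ℝ) • b) ∧ c'.IsEndpt ((k : ℝ) • d) ∧
        ((c.endSegAt ((k : ℝ) • b) S ∧ c'.endSegAt ((k : ℝ) • b) S') ∨
         (c.endSegAt ((k : ℝ) • b) S' ∧ c'.endSegAt ((k : ℝ) • b) S)))

/-- The two-sided identity of the convolution product: the covering consisting of all
curves with one segment. -/
def unitTrace (n : ℕ) : Trace n := ⟨{S | IsSeg S}, fun _ _ => False⟩

/-- `P s` realizes the power `A^s` for the convolution product. -/
def PowersOf {n : ℕ} (A : Set (Curve n)) (k : ℕ) (P : ℕ → Set (Curve n)) : Prop :=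
  (∀ s, DisjSA (P s)) ∧ traceOf (P 0) = unitTrace n ∧
  ∀ s, traceOf (P (s + 1)) = ConvTrace k A (P s)

/-- The trace of `Â`, the inductive limit of the `A^s` for `≺`. -/
def hatTrace {n : ℕ} (P : ℕ → Set (Curve n)) : Trace n :=
  ⟨{S | ∃ s, S ∈ (traceOf (P s)).segs}, fun S T => ∃ s, (traceOf (P s)).conn S T⟩

/-- A pairing relation on `E = {e_1, -e_1, …, e_n, -e_n}`. -/
def IsPairing {n : ℕ} (R : Pt n → Pt n → Prop) : Prop :=
  (∀ u v, R u v → R v u) ∧ (∀ u v, R u v → IsDir u ∧ IsDir v) ∧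
  (∀ u, ¬ R u u) ∧ ∀ u, IsDir u → ∃! v, R u v

/-- The trace of `Â_R` : `Â` with the segments with endpoint `0` connected according
to `R`. -/
def hatRTrace {n : ℕ} (P : ℕ → Set (Curve n)) (R : Pt n → Pt n → Prop) : Trace n :=
  ⟨(hatTrace P).segs,
   fun S T => (hatTrace P).conn S T ∨
     ∃ u v, R u v ∧ S = s((0 : Pt n), u) ∧ T = s((0 : Pt n), v)⟩

/-- The cube `P_{x,h}`. -/
def cube {n : ℕ} (x : Pt n) (h : ℕ) : Set (Pt n) :=
  {p | ∀ i, x i - h ≤ p i ∧ p i ≤ x i + h}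

/-- Restriction of a trace to a region `X` of `ℝ^n`. -/
def Trace.restr {n : ℕ} (T : Trace n) (X : Set (Pt n)) : Trace n :=
  ⟨{S | S ∈ T.segs ∧ segPts S ⊆ X},
   fun S S' => T.conn S S' ∧ segPts S ⊆ X ∧ segPts S' ⊆ X⟩

/-- Condition (C). -/
def CondC {n : ℕ} (T : Trace n) : Prop :=
  ∀ (x : Pt n) (h : ℕ), latt x → 1 ≤ h →
    ∃ y : Pt n, latt y ∧ y ∉ cube x h ∧
      Trace.transl (y - x) (T.restr (cube x h)) = T.restr (cube y h)

/-- `(B(x,r) ∩ T, x) ≅ (B(y,r) ∩ T', y)` : the translation sending `x` to `y` maps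
the part of `T` in the closed ball `B(x,r)` onto the part of `T'` in `B(y,r)`,
preserving the connexions between segments. -/
def BallIso {n : ℕ} (T : Trace n) (x : Pt n) (T' : Trace n) (y : Pt n) (r : ℝ) : Prop :=
  (fun p => p + (y - x)) '' (T.pts ∩ Metric.closedBall x r) =
      T'.pts ∩ Metric.closedBall y r ∧
  (∀ S S', T.conn S S' → segPts S ⊆ Metric.closedBall x r →
      segPts S' ⊆ Metric.closedBall x r →
      T'.conn (Sym2.map (fun p => p + (y - x)) S) (Sym2.map (fun p => p + (y - x)) S')) ∧
  (∀ S S', T'.conn S S' → segPts S ⊆ Metric.closedBall y r →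
      segPts S' ⊆ Metric.closedBall y r →
      T.conn (Sym2.map (fun p => p + (x - y)) S) (Sym2.map (fun p => p + (x - y)) S'))

/-- The local isomorphism property. -/
def LocIsoProp {n : ℕ} (T : Trace n) : Prop :=
  ∀ (x : Pt n) (r : ℝ), 0 ≤ r →
    ∃ t : ℝ, 0 ≤ t ∧ ∀ y : Pt n, ∃ z ∈ Metric.closedBall y t, BallIso T x T z r

/-- Two traces are locally isomorphic. -/
def LocallyIso {n : ℕ} (T T' : Trace n) : Prop :=
  (∀ (x : Pt n) (r : ℝ), 0 ≤ r → ∃ y, BallIso T x T' y r) ∧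
  (∀ (y : Pt n) (r : ℝ), 0 ≤ r → ∃ x, BallIso T' y T x r)

/-- `Ω_{s,x}` : suppress the connexions between segments whose common endpoint lies in
`x + k^s ℤ^n`. -/
def OmegaTrace {n : ℕ} (k s : ℕ) (x : Pt n) (T : Trace n) : Trace n :=
  ⟨T.segs, fun S S' => T.conn S S' ∧ ¬ ∃ p, p ∈ S ∧ p ∈ S' ∧ inLat (k ^ s) (p - x)⟩

/-- `Σ_{s,x}(E)` : for each curve `D` of `E` passing through `x`, the curve(s) with
endpoint `x` contained in `D` having maximal length, this length being limited to
`8^s`. -/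
def SigmaSet {n : ℕ} (s : ℕ) (x : Pt n) (E : Set (Curve n)) : Set (Curve n) :=
  {b | ∃ D ∈ E, SubCurve b D ∧ b.IsEndpt x ∧ b.nsegs ≤ 8 ^ s ∧
    ∀ b' : Curve n, SubCurve b' D → b'.IsEndpt x → b'.nsegs ≤ 8 ^ s →
      SubCurve b b' → SameCurve b b'}

/-- A positive (orientation preserving) isometry of `ℝ^n`. -/
def PosIsom {n : ℕ} (f : Pt n → Pt n) : Prop :=
  ∃ (g : Pt n ≃ₗᵢ[ℝ] Pt n) (t : Pt n), (∀ x, f x = g x + t) ∧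
    0 < LinearMap.det (g.toLinearEquiv.toLinearMap)

/-- `E` consists of exactly `m` curves. -/
def HasExactly {n : ℕ} (E : Set (Curve n)) (m : ℕ) : Prop :=
  ∃ L : List (Curve n), L.length = m ∧ (∀ c ∈ L, c ∈ E) ∧
    L.Pairwise (fun c d => ¬ SameCurve c d) ∧ ∀ c ∈ E, ∃ d ∈ L, SameCurve c d

/-- `E` consists of at most `m` curves. -/
def AtMost {n : ℕ} (E : Set (Curve n)) (m : ℕ) : Prop :=
  ∃ L : List (Curve n), L.length ≤ m ∧ ∀ c ∈ E, ∃ d ∈ L, SameCurve c d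

/-- The set of points of a curve. -/
def curvePts {n : ℕ} (c : Curve n) : Set (Pt n) := ⋃ S ∈ c.segs, segPts S

namespace Curve

variable {n : ℕ} {c d : Curve n} {p : Pt n} {S T : Sym2 (Pt n)}

theorem mem_dom_of_le {a b m : ℤ} (ha : a ∈ c.dom) (hb : b ∈ c.dom) (h₁ : a ≤ m)
    (h₂ : m ≤ b) : m ∈ c.dom :=
  c.ordConn.out ha hb ⟨h₁, h₂⟩

theorem v_ne_v_succ {i : ℤ} (h : i ∈ c.dom) (h' : i + 1 ∈ c.dom) : c.v i ≠ c.v (i + 1) := by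
  have hu (j : Fin n) : uvec n j ≠ 0 := by simp [uvec]
  obtain ⟨j, hj | hj⟩ := c.step i h h'
  · rw [hj]; simpa using hu j
  · rw [hj]; simpa [sub_eq_add_neg] using hu j

theorem ne_of_mem_segs {a b : Pt n} (h : s(a, b) ∈ c.segs) : a ≠ b := by
  obtain ⟨i, hi, hi', e⟩ := h
  have := v_ne_v_succ hi hi'
  rcases Sym2.eq_iff.1 e with ⟨rfl, rfl⟩ | ⟨rfl, rfl⟩
  exacts [this, this.symm]

theorem exists_mk_of_mem_segs {a b : Pt n} (h : s(a, b) ∈ c.segs) :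
    ∃ x j, latt x ∧ s(a, b) = s(x, x + uvec n j) := by
  obtain ⟨i, hi, hi', e⟩ := h
  obtain ⟨j, hj | hj⟩ := c.step i hi hi'
  · exact ⟨c.v i, j, c.lattice i hi, by rw [e, hj]⟩
  · exact ⟨c.v (i + 1), j, c.lattice _ hi', by rw [e, hj, sub_add_cancel, Sym2.eq_swap]⟩

theorem conn_symm (h : c.conn S T) : c.conn T S := by
  obtain ⟨i, h₁, h₂, h⟩ := h
  exact ⟨i, h₁, h₂, h.symm⟩

theorem left_mem_of_conn (h : c.conn S T) : S ∈ c.segs := by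
  obtain ⟨i, h₁, h₂, h⟩ := h
  have hi : i ∈ c.dom := mem_dom_of_le h₁ h₂ (by lia) (by lia)
  rcases h with ⟨h, -⟩ | ⟨-, h⟩
  · exact ⟨i - 1, h₁, by simpa using hi, by simpa using h⟩
  · exact ⟨i, hi, h₂, h⟩

theorem right_mem_of_conn (h : c.conn S T) : T ∈ c.segs :=
  left_mem_of_conn (conn_symm h)

theorem conn_ne (h : c.conn S T) : S ≠ T := by
  obtain ⟨i, h₁, h₂, h⟩ := h
  have hi : i ∈ c.dom := mem_dom_of_le h₁ h₂ (by lia) (by lia)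
  have hn := c.noback i h₁ h₂
  have hne := v_ne_v_succ hi h₂
  have key : s(c.v (i - 1), c.v i) ≠ s(c.v i, c.v (i + 1)) := by
    intro e
    rcases Sym2.eq_iff.1 e with ⟨e₁, e₂⟩ | ⟨e₁, e₂⟩
    · exact hne e₂
    · exact hn e₁.symm
  rcases h with ⟨rfl, rfl⟩ | ⟨rfl, rfl⟩
  exacts [key, key.symm]

theorem isEndpt_iff_exists_endSegAt : c.IsEndpt p ↔ ∃ S, c.endSegAt p S := by
  constructor
  · rintro ⟨i, hi, rfl, h⟩
    obtain ⟨m, hm, hm'⟩ := c.nontriv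
    rcases h with h | h
    · have hmi : i ≤ m := by
        by_contra hlt
        exact h (mem_dom_of_le hm hi (by lia) (by lia))
      exact ⟨_, i, hi, rfl, .inl ⟨h, mem_dom_of_le hi hm' (by lia) (by lia), rfl⟩⟩
    · have hmi : m + 1 ≤ i := by
        by_contra hlt
        exact h (mem_dom_of_le hi hm' (by lia) (by lia))
      exact ⟨_, i, hi, rfl, .inr ⟨h, mem_dom_of_le hm hi (by lia) (by lia), rfl⟩⟩
  · rintro ⟨S, i, hi, rfl, ⟨h, -⟩ | ⟨h, -⟩⟩
    exacts [⟨i, hi, rfl, .inl h⟩, ⟨i, hi, rfl, .inr h⟩]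

/-- The end segments of a self-avoiding curve are described by its trace. -/
theorem SelfAvoiding.endSegAt_iff (hc : c.SelfAvoiding) :
    c.endSegAt p S ↔ S ∈ c.segs ∧ p ∈ S ∧ ∀ T, c.conn S T → p ∉ T := by
  constructor
  · rintro ⟨i, hi, rfl, ⟨h₁, h₂, rfl⟩ | ⟨h₁, h₂, rfl⟩⟩
    · refine ⟨⟨i, hi, h₂, rfl⟩, by simp, ?_⟩
      rintro T ⟨m, hm, hm', ⟨e, rfl⟩ | ⟨rfl, e⟩⟩ hT
      · have hmi : m ∈ c.dom := mem_dom_of_le hm hm' (by lia) (by lia)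
        have := hc i (m - 1) hi h₂ hm (by simpa using hmi) (by simpa using e)
        obtain rfl : m = i + 1 := by lia
        rcases Sym2.mem_iff.1 hT with e | e
        · exact v_ne_v_succ hi h₂ e
        · exact c.noback (i + 1) hm hm' (by simpa using e.symm)
      · have hmi : m ∈ c.dom := mem_dom_of_le hm hm' (by lia) (by lia)
        obtain rfl := hc i m hi h₂ hmi hm' e
        exact h₁ hm
    · refine ⟨⟨i - 1, h₂, by simpa using hi, by simp⟩, by simp, ?_⟩
      rintro T ⟨m, hm, hm', ⟨e, rfl⟩ | ⟨rfl, e⟩⟩ hT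
      · have hmi : m ∈ c.dom := mem_dom_of_le hm hm' (by lia) (by lia)
        have := hc (i - 1) (m - 1) h₂ (by simpa using hi) hm (by simpa using hmi)
          (by simpa using e)
        obtain rfl : m = i := by lia
        exact h₁ hm'
      · have hmi : m ∈ c.dom := mem_dom_of_le hm hm' (by lia) (by lia)
        have := hc (i - 1) m h₂ (by simpa using hi) hmi hm' (by simpa using e)
        obtain rfl : i = m + 1 := by lia
        rcases Sym2.mem_iff.1 hT with e | e
        · exact c.noback m hm hm' e
        · exact v_ne_v_succ hmi hm' e.symm
  · rintro ⟨⟨i, hi, hi', rfl⟩, hp, h⟩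
    rcases Sym2.mem_iff.1 hp with rfl | rfl
    · refine ⟨i, hi, rfl, .inl ⟨fun hm => ?_, hi', rfl⟩⟩
      exact h _ ⟨i, hm, hi', .inr ⟨rfl, rfl⟩⟩ (by simp)
    · refine ⟨i + 1, hi', rfl, .inr ⟨fun hm => ?_, by simpa using hi, by simp⟩⟩
      exact h _ ⟨i + 1, by simpa using hi, hm, .inl ⟨by simp, rfl⟩⟩ (by simp)

/-- If each segment of a curve is represented by a nonempty `r`-connected class `P i`, and if the
classes of consecutive segments are joined by `r`, then all the representatives are joined. -/
theorem reflTransGen_of_consecutive {α : Type*} {r : α → α → Prop} (hr : ∀ x y, r x y → r y x)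
    {P : ℤ → α → Prop}
    (h₁ : ∀ i x y, i ∈ c.dom → i + 1 ∈ c.dom → P i x → P i y → Relation.ReflTransGen r x y)
    (h₂ : ∀ i, i - 1 ∈ c.dom → i + 1 ∈ c.dom → ∃ x y, P (i - 1) x ∧ P i y ∧ r x y)
    {i m : ℤ} (hi : i ∈ c.dom) (hi' : i + 1 ∈ c.dom) (hm : m ∈ c.dom) (hm' : m + 1 ∈ c.dom)
    {x y : α} (hx : P i x) (hy : P m y) : Relation.ReflTransGen r x y := by
  have main (t : ℕ) : ∀ i x y, i ∈ c.dom → i + t + 1 ∈ c.dom → P i x → P (i + t) y →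
      Relation.ReflTransGen r x y := by
    induction t with
    | zero =>
      intro i x y hi hi' hx hy
      simp only [Nat.cast_zero, add_zero] at hi' hy
      exact h₁ i x y hi hi' hx hy
    | succ t ih =>
      intro i x y hi hi' hx hy
      push_cast at hi' hy
      obtain ⟨z, w, hz, hw, hzw⟩ := h₂ (i + t + 1)
        (mem_dom_of_le hi hi' (by lia) (by lia)) (by rwa [add_assoc i] )
      refine (ih i x z hi (mem_dom_of_le hi hi' (by lia) (by lia)) hx (by simpa using hz)).trans
        (.head hzw (h₁ (i + t + 1) w y (mem_dom_of_le hi hi' (by lia) (by lia))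
          (by rwa [add_assoc i]) hw (by rwa [add_assoc i])))
  have symm {x y : α} (h : Relation.ReflTransGen r x y) : Relation.ReflTransGen r y x := by
    induction h with
    | refl => exact .refl
    | tail _ h ih => exact .head (hr _ _ h) ih
  rcases le_total i m with h | h
  · obtain ⟨t, rfl⟩ := Int.le.dest h
    exact main t i x y hi hm' hx hy
  · obtain ⟨t, rfl⟩ := Int.le.dest h
    exact symm (main t m y x hm hi' hy hx)

theorem reflTransGen_conn (hS : S ∈ c.segs) (hT : T ∈ c.segs) :
    Relation.ReflTransGen c.conn S T := by
  obtain ⟨i, hi, hi', rfl⟩ := hS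
  obtain ⟨m, hm, hm', rfl⟩ := hT
  refine reflTransGen_of_consecutive (P := fun i S => S = s(c.v i, c.v (i + 1)))
    (fun _ _ => conn_symm) ?_ ?_ hi hi' hm hm' rfl rfl
  · rintro i _ _ - - rfl rfl
    exact .refl
  · intro i h h'
    exact ⟨_, _, rfl, rfl, i, h, h', .inl ⟨by simp, rfl⟩⟩

end Curve

section Convolution

variable {n : ℕ} {A B P : Set (Curve n)} {i j : ℕ} {c c' d p : Curve n}
  {S T : Sym2 (Pt n)} {a b a' b' x q : Pt n}

theorem mem_segs_traceOf_singleton : S ∈ (traceOf {d}).segs ↔ S ∈ d.segs := by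
  simp [traceOf]

theorem conn_traceOf_singleton : (traceOf {d}).conn S T ↔ d.conn S T := by
  simp [traceOf]

theorem DisjSA.sameCurve (hA : DisjSA A) (hc : c ∈ A) (hc' : c' ∈ A) (h : S ∈ c.segs)
    (h' : S ∈ c'.segs) : SameCurve c c' := by
  by_contra hn
  exact hA.2 c hc c' hc' hn S h h'

theorem DisjSA.conn_iff (hA : DisjSA A) (hc : c ∈ A) (h : S ∈ c.segs) :
    (traceOf A).conn S T ↔ c.conn S T := by
  refine ⟨?_, fun h' => ⟨c, hc, h'⟩⟩
  rintro ⟨c', hc', h'⟩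
  rw [(hA.sameCurve hc hc' h (Curve.left_mem_of_conn h')).2]
  exact h'

theorem DisjSA.endSegAt_iff (hA : DisjSA A) (hc : c ∈ A) :
    c.endSegAt x S ↔ S ∈ c.segs ∧ x ∈ S ∧ ∀ T, (traceOf A).conn S T → x ∉ T := by
  rw [(hA.1 c hc).endSegAt_iff]
  refine and_congr_right fun h => and_congr_right fun _ => forall_congr' fun T => ?_
  rw [hA.conn_iff hc h]

theorem DisjSA.endSegAt_congr (hA : DisjSA A) (hc : c ∈ A) (hc' : c' ∈ A)
    (h : SameCurve c c') : c.endSegAt x S ↔ c'.endSegAt x S := by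
  rw [hA.endSegAt_iff hc, hA.endSegAt_iff hc', h.1]

theorem DisjSA.isEndpt_congr (hA : DisjSA A) (hc : c ∈ A) (hc' : c' ∈ A)
    (h : SameCurve c c') : c.IsEndpt x ↔ c'.IsEndpt x := by
  simp only [Curve.isEndpt_iff_exists_endSegAt, hA.endSegAt_congr hc hc' h]

theorem SatH.disjSA (hA : SatH A i j) : DisjSA A := hA.2.2.2.1.1

theorem SatH.ne_zero (hA : SatH A i j) : (i : ℝ) ≠ 0 := by exact_mod_cast hA.1.ne'

theorem SatH.smul_inj (hA : SatH A i j) : (i : ℝ) • a = (i : ℝ) • b ↔ a = b :=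
  smul_right_inj hA.ne_zero

theorem SatH.eq_or_eq_of_isEndpt (hA : SatH A i j) (hc : c ∈ A) (ha : c.IsEndpt a)
    (hb : c.IsEndpt b) (hab : a ≠ b) (hx : c.IsEndpt x) : x = a ∨ x = b := by
  obtain ⟨-, y, m, -, -, -, -, h⟩ := hA.2.2.2.2.1 c hc
  have h₁ := h a ha
  have h₂ := h b hb
  have h₃ := h x hx
  grind

theorem latt_smul (i : ℕ) (hx : latt x) : latt ((i : ℝ) • x) := fun t => by
  obtain ⟨z, hz⟩ := hx t
  exact ⟨i * z, by simp [hz]⟩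

theorem inLat_smul (i : ℕ) (hx : latt x) : inLat i ((i : ℝ) • x) := fun t => by
  obtain ⟨z, hz⟩ := hx t
  exact ⟨z, by simp [hz]⟩

theorem SatH.exists_isEndpt (hA : SatH A i j) (h : s(a, b) ∈ (traceOf B).segs) :
    ∃ c ∈ A, c.IsEndpt ((i : ℝ) • a) ∧ c.IsEndpt ((i : ℝ) • b) := by
  obtain ⟨d, -, h⟩ := h
  obtain ⟨x, m, hx, e⟩ := Curve.exists_mk_of_mem_segs h
  obtain ⟨c, hc, hc₁, hc₂⟩ := (hA.2.2.2.2.2.1 _ m (latt_smul i hx) (inLat_smul i hx)).1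
  rw [← smul_add] at hc₂
  rcases Sym2.eq_iff.1 e with ⟨rfl, rfl⟩ | ⟨rfl, rfl⟩
  exacts [⟨c, hc, hc₁, hc₂⟩, ⟨c, hc, hc₂, hc₁⟩]

theorem SatH.sameCurve_of_isEndpt (hA : SatH A i j) (h : s(a, b) ∈ (traceOf B).segs)
    (hc : c ∈ A) (hc' : c' ∈ A) (ha : c.IsEndpt ((i : ℝ) • a)) (hb : c.IsEndpt ((i : ℝ) • b))
    (ha' : c'.IsEndpt ((i : ℝ) • a)) (hb' : c'.IsEndpt ((i : ℝ) • b)) : SameCurve c c' := by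
  obtain ⟨d, -, h⟩ := h
  obtain ⟨x, m, hx, e⟩ := Curve.exists_mk_of_mem_segs h
  have hu := (hA.2.2.2.2.2.1 _ m (latt_smul i hx) (inLat_smul i hx)).2 c hc c' hc'
  rw [← smul_add] at hu
  rcases Sym2.eq_iff.1 e with ⟨rfl, rfl⟩ | ⟨rfl, rfl⟩
  exacts [hu ha hb ha' hb', hu hb ha hb' ha']

theorem ne_of_mem_traceOf (h : s(a, b) ∈ (traceOf B).segs) : a ≠ b := by
  obtain ⟨d, -, h⟩ := h
  exact Curve.ne_of_mem_segs h

theorem left_mem_of_traceOf_conn (h : (traceOf B).conn S T) : S ∈ (traceOf B).segs := by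
  obtain ⟨d, hd, h⟩ := h
  exact ⟨d, hd, Curve.left_mem_of_conn h⟩

theorem right_mem_of_traceOf_conn (h : (traceOf B).conn S T) : T ∈ (traceOf B).segs := by
  obtain ⟨d, hd, h⟩ := h
  exact ⟨d, hd, Curve.right_mem_of_conn h⟩

/-- The segment replaced by a curve of `A` is determined by any segment of this curve. -/
theorem SatH.mk_eq_mk (hA : SatH A i j) (hc : c ∈ A) (hc' : c' ∈ A)
    (ha : c.IsEndpt ((i : ℝ) • a)) (hb : c.IsEndpt ((i : ℝ) • b)) (hab : a ≠ b)
    (ha' : c'.IsEndpt ((i : ℝ) • a')) (hb' : c'.IsEndpt ((i : ℝ) • b')) (hab' : a' ≠ b')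
    (hS : S ∈ c.segs) (hS' : S ∈ c'.segs) : s(a, b) = s(a', b') := by
  have hs := hA.disjSA.sameCurve hc hc' hS hS'
  rw [← hA.disjSA.isEndpt_congr hc hc' hs] at ha' hb'
  have hne : (i : ℝ) • a ≠ (i : ℝ) • b := by rwa [Ne, hA.smul_inj]
  have h₁ := hA.eq_or_eq_of_isEndpt hc ha hb hne ha'
  have h₂ := hA.eq_or_eq_of_isEndpt hc ha hb hne hb'
  simp only [hA.smul_inj] at h₁ h₂
  rw [Sym2.eq_iff]
  grind

theorem endSegAt_mem_segs (h : c.endSegAt x S) : S ∈ c.segs := by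
  obtain ⟨m, hm, -, ⟨-, h, rfl⟩ | ⟨-, h, rfl⟩⟩ := h
  · exact ⟨m, hm, h, rfl⟩
  · exact ⟨m - 1, h, by simpa using hm, by simp⟩

theorem convTrace_conn_symm (h : (ConvTrace i A B).conn S T) : (ConvTrace i A B).conn T S := by
  rcases h with ⟨a, b, h, c, hc, ha, hb, h'⟩ | ⟨a, b, d, h, c, hc, c', hc', h₁, h₂, h₃, h₄, h'⟩
  · exact .inl ⟨a, b, h, c, hc, ha, hb, Curve.conn_symm h'⟩
  · exact .inr ⟨a, b, d, h, c, hc, c', hc', h₁, h₂, h₃, h₄, h'.symm⟩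

/-- A convenient form of the second kind of connexion in a convolution product. -/
theorem convTrace_conn_of_endSegAt {e : Pt n}
    (h : (traceOf B).conn s(b, a) s(b, e)) (hc : c ∈ A) (hc' : c' ∈ A)
    (h₁ : c.IsEndpt ((i : ℝ) • a)) (h₂ : c'.IsEndpt ((i : ℝ) • e))
    (h₃ : c.endSegAt ((i : ℝ) • b) S) (h₄ : c'.endSegAt ((i : ℝ) • b) T) :
    (ConvTrace i A B).conn S T :=
  .inr ⟨a, b, e, by rwa [Sym2.eq_swap (a := a)], c, hc, c', hc', h₁,
    Curve.isEndpt_iff_exists_endSegAt.2 ⟨_, h₃⟩, Curve.isEndpt_iff_exists_endSegAt.2 ⟨_, h₄⟩, h₂,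
    .inl ⟨h₃, h₄⟩⟩

theorem traceOf_conn_symm (h : (traceOf B).conn S T) : (traceOf B).conn T S := by
  obtain ⟨d, hd, h⟩ := h
  exact ⟨d, hd, Curve.conn_symm h⟩

theorem convTrace_conn_cases (h : (ConvTrace i A B).conn S T) :
    (∃ a b : Pt n, s(a, b) ∈ (traceOf B).segs ∧
      ∃ c ∈ A, c.IsEndpt ((i : ℝ) • a) ∧ c.IsEndpt ((i : ℝ) • b) ∧ c.conn S T) ∨
    ∃ a b e : Pt n, (traceOf B).conn s(b, a) s(b, e) ∧ ∃ c ∈ A, ∃ c' ∈ A,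
      c.IsEndpt ((i : ℝ) • a) ∧ c'.IsEndpt ((i : ℝ) • e) ∧
      c.endSegAt ((i : ℝ) • b) S ∧ c'.endSegAt ((i : ℝ) • b) T := by
  refine h.imp_right ?_
  rintro ⟨a, b, d, h, c, hc, c', hc', h₁, -, -, h₄, ⟨h₅, h₆⟩ | ⟨h₅, h₆⟩⟩
  · exact ⟨a, b, d, by rwa [Sym2.eq_swap (a := b) (b := a)], c, hc, c', hc', h₁, h₄, h₅, h₆⟩
  · exact ⟨d, b, a, by rw [Sym2.eq_swap (a := b) (b := a)]; exact traceOf_conn_symm h,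
      c', hc', c, hc, h₄, h₁, h₆, h₅⟩

theorem convTrace_singleton_segs_subset (hd : d ∈ B) :
    (ConvTrace i A {d}).segs ⊆ (ConvTrace i A B).segs := by
  rintro S ⟨a, b, h, h'⟩
  exact ⟨a, b, ⟨d, hd, mem_segs_traceOf_singleton.1 h⟩, h'⟩

theorem convTrace_singleton_conn (hA : SatH A i j) (hB : DisjSA B) (hd : d ∈ B) :
    (ConvTrace i A {d}).conn S T ↔
      S ∈ (ConvTrace i A {d}).segs ∧ (ConvTrace i A B).conn S T := by
  constructor
  · intro h
    rcases convTrace_conn_cases h with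
      ⟨a, b, h, c, hc, ha, hb, h'⟩ | ⟨a, b, e, h, c, hc, c', hc', h₁, h₂, h₃, h₄⟩
    · exact ⟨⟨a, b, h, c, hc, ha, hb, Curve.left_mem_of_conn h'⟩,
        .inl ⟨a, b, ⟨d, hd, mem_segs_traceOf_singleton.1 h⟩, c, hc, ha, hb, h'⟩⟩
    · exact ⟨⟨b, a, left_mem_of_traceOf_conn h, c, hc,
          Curve.isEndpt_iff_exists_endSegAt.2 ⟨_, h₃⟩, h₁, endSegAt_mem_segs h₃⟩,
        convTrace_conn_of_endSegAt ⟨d, hd, conn_traceOf_singleton.1 h⟩ hc hc' h₁ h₂ h₃ h₄⟩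
  · rintro ⟨⟨x, y, hxy, c₀, hc₀, hx, hy, hS⟩, h⟩
    have hne := ne_of_mem_traceOf hxy
    rcases convTrace_conn_cases h with
      ⟨a, b, h, c, hc, ha, hb, h'⟩ | ⟨a, b, e, h, c, hc, c', hc', h₁, h₂, h₃, h₄⟩
    · have e := hA.mk_eq_mk hc₀ hc hx hy hne ha hb (ne_of_mem_traceOf h) hS
        (Curve.left_mem_of_conn h')
      exact .inl ⟨a, b, e ▸ hxy, c, hc, ha, hb, h'⟩
    · have e := hA.mk_eq_mk hc₀ hc hx hy hne (Curve.isEndpt_iff_exists_endSegAt.2 ⟨_, h₃⟩) h₁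
        (ne_of_mem_traceOf (left_mem_of_traceOf_conn h)) hS (endSegAt_mem_segs h₃)
      rw [e, mem_segs_traceOf_singleton] at hxy
      exact convTrace_conn_of_endSegAt (conn_traceOf_singleton.2 ((hB.conn_iff hd hxy).1 h))
        hc hc' h₁ h₂ h₃ h₄

theorem convTrace_singleton_right_mem (h : (ConvTrace i A {d}).conn S T) :
    T ∈ (ConvTrace i A {d}).segs := by
  rcases convTrace_conn_cases h with
    ⟨a, b, h, c, hc, ha, hb, h'⟩ | ⟨a, b, e, h, c, hc, c', hc', h₁, h₂, h₃, h₄⟩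
  · exact ⟨a, b, h, c, hc, ha, hb, Curve.right_mem_of_conn h'⟩
  · exact ⟨b, e, right_mem_of_traceOf_conn h, c', hc',
      Curve.isEndpt_iff_exists_endSegAt.2 ⟨_, h₄⟩, h₂, endSegAt_mem_segs h₄⟩

theorem convTrace_singleton_reflTransGen (hA : SatH A i j)
    (hS : S ∈ (ConvTrace i A {d}).segs) (hT : T ∈ (ConvTrace i A {d}).segs) :
    Relation.ReflTransGen (ConvTrace i A {d}).conn S T := by
  set R : ℤ → Sym2 (Pt n) → Prop := fun m S => ∃ c ∈ A,
    c.IsEndpt ((i : ℝ) • d.v m) ∧ c.IsEndpt ((i : ℝ) • d.v (m + 1)) ∧ S ∈ c.segs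
  have key {S} (hS : S ∈ (ConvTrace i A {d}).segs) : ∃ m, m ∈ d.dom ∧ m + 1 ∈ d.dom ∧ R m S := by
    obtain ⟨a, b, h, c, hc, ha, hb, h'⟩ := hS
    obtain ⟨m, hm, hm', e⟩ := mem_segs_traceOf_singleton.1 h
    refine ⟨m, hm, hm', c, hc, ?_⟩
    rcases Sym2.eq_iff.1 e with ⟨rfl, rfl⟩ | ⟨rfl, rfl⟩
    exacts [⟨ha, hb, h'⟩, ⟨hb, ha, h'⟩]
  have seg {m : ℤ} (hm : m ∈ d.dom) (hm' : m + 1 ∈ d.dom) :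
      s(d.v m, d.v (m + 1)) ∈ (traceOf {d}).segs :=
    mem_segs_traceOf_singleton.2 ⟨m, hm, hm', rfl⟩
  obtain ⟨m, hm, hm', hmS⟩ := key hS
  obtain ⟨t, ht, ht', htT⟩ := key hT
  refine Curve.reflTransGen_of_consecutive (c := d) (P := R) (fun _ _ => convTrace_conn_symm)
    ?_ ?_ hm hm' ht ht' hmS htT
  · rintro m S T hm hm' ⟨c, hc, h₁, h₂, h⟩ ⟨c', hc', h₁', h₂', h'⟩
    have hs := hA.sameCurve_of_isEndpt (seg hm hm') hc hc' h₁ h₂ h₁' h₂'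
    rw [← hs.1] at h'
    exact (Curve.reflTransGen_conn h h').lift id
      fun U V hUV => .inl ⟨_, _, seg hm hm', c, hc, h₁, h₂, hUV⟩
  · intro m hm hm'
    have hmm : m ∈ d.dom := Curve.mem_dom_of_le hm hm' (by lia) (by lia)
    have hs := seg hm (by simpa using hmm)
    rw [sub_add_cancel] at hs
    obtain ⟨c, hc, h₁, h₂⟩ := hA.exists_isEndpt hs
    obtain ⟨c', hc', h₁', h₂'⟩ := hA.exists_isEndpt (seg hmm hm')
    obtain ⟨U, hU⟩ := Curve.isEndpt_iff_exists_endSegAt.1 h₂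
    obtain ⟨V, hV⟩ := Curve.isEndpt_iff_exists_endSegAt.1 h₁'
    refine ⟨U, V, ⟨c, hc, h₁, by simpa using h₂, endSegAt_mem_segs hU⟩,
      ⟨c', hc', h₁', h₂', endSegAt_mem_segs hV⟩,
      convTrace_conn_of_endSegAt (conn_traceOf_singleton.2 ⟨m, hm, hm', .inl ⟨?_, rfl⟩⟩)
        hc hc' h₁ h₂' hU hV⟩
    exact Sym2.eq_swap

/-- The curve `p` is obtained from `d` by the homothety of ratio `i` and the replacement of each
resulting segment by a curve of `A`. -/
def IsSubst (i : ℕ) (A : Set (Curve n)) (d p : Curve n) : Prop :=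
  p.segs = (ConvTrace i A {d}).segs ∧ p.conn = (ConvTrace i A {d}).conn

theorem isSubst_of_mem (hA : SatH A i j) (hB : DisjSA B) (hP : DisjSA P)
    (hPt : traceOf P = ConvTrace i A B) (hd : d ∈ B) (hp : p ∈ P) (hSp : S ∈ p.segs)
    (hS : S ∈ (ConvTrace i A {d}).segs) : IsSubst i A d p := by
  have hsegs : p.segs = (ConvTrace i A {d}).segs := by
    ext T
    constructor
    · intro hT
      have := Curve.reflTransGen_conn hSp hT
      clear hT
      induction this with
      | refl => exact hS
      | tail _ h ih =>
        refine convTrace_singleton_right_mem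
          ((convTrace_singleton_conn hA hB hd).2 ⟨ih, ?_⟩)
        rw [← hPt]
        exact ⟨p, hp, h⟩
    · intro hT
      have := convTrace_singleton_reflTransGen hA hS hT
      clear hT
      induction this with
      | refl => exact hSp
      | tail _ h ih =>
        have h := ((convTrace_singleton_conn hA hB hd).1 h).2
        rw [← hPt] at h
        exact Curve.right_mem_of_conn ((hP.conn_iff hp ih).1 h)
  refine ⟨hsegs, ?_⟩
  ext U V
  rw [convTrace_singleton_conn hA hB hd, ← hPt, ← hsegs]
  constructor
  · intro h
    exact ⟨Curve.left_mem_of_conn h, p, hp, h⟩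
  · rintro ⟨hU, h⟩
    exact (hP.conn_iff hp hU).1 h

theorem exists_isSubst_right (hA : SatH A i j) (hB : DisjSA B) (hP : DisjSA P)
    (hPt : traceOf P = ConvTrace i A B) (hd : d ∈ B) : ∃ p ∈ P, IsSubst i A d p := by
  obtain ⟨m, hm, hm'⟩ := d.nontriv
  have hs : s(d.v m, d.v (m + 1)) ∈ (traceOf {d}).segs :=
    mem_segs_traceOf_singleton.2 ⟨m, hm, hm', rfl⟩
  obtain ⟨c, hc, h₁, h₂⟩ := hA.exists_isEndpt hs
  obtain ⟨S, hS⟩ := Curve.isEndpt_iff_exists_endSegAt.1 h₁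
  have hS' : S ∈ (ConvTrace i A {d}).segs := ⟨_, _, hs, c, hc, h₁, h₂, endSegAt_mem_segs hS⟩
  have hSB := convTrace_singleton_segs_subset hd hS'
  rw [← hPt] at hSB
  obtain ⟨p, hp, hSp⟩ := hSB
  exact ⟨p, hp, isSubst_of_mem hA hB hP hPt hd hp hSp hS'⟩

theorem exists_isSubst_left (hA : SatH A i j) (hB : DisjSA B) (hP : DisjSA P)
    (hPt : traceOf P = ConvTrace i A B) (hp : p ∈ P) : ∃ d ∈ B, IsSubst i A d p := by
  obtain ⟨m, hm, hm'⟩ := p.nontriv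
  have hs : s(p.v m, p.v (m + 1)) ∈ p.segs := ⟨m, hm, hm', rfl⟩
  have hs' : s(p.v m, p.v (m + 1)) ∈ (ConvTrace i A B).segs := by
    rw [← hPt]
    exact ⟨p, hp, hs⟩
  obtain ⟨a, b, ⟨d, hd, hab⟩, h⟩ := hs'
  exact ⟨d, hd, isSubst_of_mem hA hB hP hPt hd hp hs ⟨a, b, mem_segs_traceOf_singleton.2 hab, h⟩⟩

theorem endSegAt_of_isSubst (hA : SatH A i j) (hB : DisjSA B) (hP : DisjSA P) (hd : d ∈ B)
    (hp : p ∈ P) (h : IsSubst i A d p) {r u : Pt n} (hr : d.endSegAt r s(r, u)) (hc : c ∈ A)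
    (hu : c.IsEndpt ((i : ℝ) • u)) (hS : c.endSegAt ((i : ℝ) • r) S) :
    p.endSegAt ((i : ℝ) • r) S := by
  have hru := (hB.1 d hd).endSegAt_iff.1 hr
  have hne := Curve.ne_of_mem_segs hru.1
  have hri : c.IsEndpt ((i : ℝ) • r) := Curve.isEndpt_iff_exists_endSegAt.2 ⟨_, hS⟩
  have hSc := (hA.disjSA.1 c hc).endSegAt_iff.1 hS
  refine (hP.1 p hp).endSegAt_iff.2 ⟨?_, hSc.2.1, ?_⟩
  · rw [h.1]
    exact ⟨r, u, mem_segs_traceOf_singleton.2 hru.1, c, hc, hri, hu, hSc.1⟩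
  · intro T hT hrT
    rw [h.2] at hT
    rcases convTrace_conn_cases hT with
      ⟨a, b, -, c', hc', -, -, h'⟩ | ⟨a, b, e, hab, c', hc', c'', hc'', h₁, h₂, h₃, h₄⟩
    · have hs := hA.disjSA.sameCurve hc hc' hSc.1 (Curve.left_mem_of_conn h')
      rw [← hs.2] at h'
      exact hSc.2.2 T h' hrT
    · have hb : c'.IsEndpt ((i : ℝ) • b) := Curve.isEndpt_iff_exists_endSegAt.2 ⟨_, h₃⟩
      have hb' : c''.IsEndpt ((i : ℝ) • b) := Curve.isEndpt_iff_exists_endSegAt.2 ⟨_, h₄⟩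
      have hSc' := endSegAt_mem_segs h₃
      have hba := ne_of_mem_traceOf (left_mem_of_traceOf_conn hab)
      have hbe := ne_of_mem_traceOf (right_mem_of_traceOf_conn hab)
      have e₁ := hA.mk_eq_mk hc hc' hri hu hne hb h₁ hba hSc.1 hSc'
      rw [conn_traceOf_singleton] at hab
      rcases Sym2.eq_iff.1 e₁ with ⟨rfl, rfl⟩ | ⟨rfl, rfl⟩
      · exact hru.2.2 _ hab (by simp)
      -- Otherwise `S` and `T` both have the endpoints `i • r` and `i • u`.
      · have hne' : (i : ℝ) • r ≠ (i : ℝ) • u := by rwa [Ne, hA.smul_inj]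
        have huS := ((hA.disjSA.1 c' hc').endSegAt_iff.1 h₃).2.1
        have hT' := (hA.disjSA.1 c'' hc'').endSegAt_iff.1 h₄
        have eS := (Sym2.mem_and_mem_iff hne').1 ⟨hSc.2.1, huS⟩
        have eT := (Sym2.mem_and_mem_iff hne').1 ⟨hrT, hT'.2.1⟩
        rw [← eS] at eT
        rw [eT] at hT'
        exact Curve.conn_ne hab (hA.mk_eq_mk hc' hc'' hb h₁ hba hb' h₂ hbe hSc' hT'.1)

theorem exists_endSegAt_of_isSubst (hA : SatH A i j) (hB : DisjSA B) (hP : DisjSA P)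
    (hd : d ∈ B) (hp : p ∈ P) (h : IsSubst i A d p) (hS : p.endSegAt q S) :
    ∃ r u, q = (i : ℝ) • r ∧ d.endSegAt r s(r, u) ∧
      ∃ c ∈ A, c.IsEndpt ((i : ℝ) • u) ∧ c.endSegAt ((i : ℝ) • r) S := by
  obtain ⟨hSp, hq, hT⟩ := (hP.1 p hp).endSegAt_iff.1 hS
  have hSp' := hSp
  rw [h.1] at hSp'
  obtain ⟨a, b, hab, c, hc, ha, hb, hSc⟩ := hSp'
  have hcS : c.endSegAt q S := by
    refine (hA.disjSA.1 c hc).endSegAt_iff.2 ⟨hSc, hq, fun T h' => hT T ?_⟩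
    rw [h.2]
    exact .inl ⟨a, b, hab, c, hc, ha, hb, h'⟩
  have main {r u} (hru : s(r, u) ∈ (traceOf {d}).segs) (hu : c.IsEndpt ((i : ℝ) • u))
      (hqr : q = (i : ℝ) • r) : ∃ r u, q = (i : ℝ) • r ∧ d.endSegAt r s(r, u) ∧
      ∃ c ∈ A, c.IsEndpt ((i : ℝ) • u) ∧ c.endSegAt ((i : ℝ) • r) S := by
    refine ⟨r, u, hqr, ?_, c, hc, hu, hqr ▸ hcS⟩
    refine (hB.1 d hd).endSegAt_iff.2 ⟨mem_segs_traceOf_singleton.1 hru, by simp, ?_⟩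
    intro T hdT hrT
    obtain ⟨e, rfl⟩ := Sym2.mem_iff_exists.1 hrT
    rw [← conn_traceOf_singleton] at hdT
    obtain ⟨c', hc', h₁, h₂⟩ := hA.exists_isEndpt (right_mem_of_traceOf_conn hdT)
    obtain ⟨U, hU⟩ := Curve.isEndpt_iff_exists_endSegAt.1 h₁
    refine hT U ?_ (hqr ▸ ((hA.disjSA.1 c' hc').endSegAt_iff.1 hU).2.1)
    rw [h.2]
    exact convTrace_conn_of_endSegAt hdT hc hc' hu h₂ (hqr ▸ hcS) hU
  have hne : (i : ℝ) • a ≠ (i : ℝ) • b := by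
    rw [Ne, hA.smul_inj]
    exact ne_of_mem_traceOf hab
  rcases hA.eq_or_eq_of_isEndpt hc ha hb hne
    (Curve.isEndpt_iff_exists_endSegAt.2 ⟨_, hcS⟩) with e | e
  · exact main hab hb e
  · exact main (by rwa [Sym2.eq_swap]) ha e

theorem isEndpt_iff_of_isSubst (hA : SatH A i j) (hB : DisjSA B) (hP : DisjSA P)
    (hd : d ∈ B) (hp : p ∈ P) (h : IsSubst i A d p) {r : Pt n} :
    p.IsEndpt ((i : ℝ) • r) ↔ d.IsEndpt r := by
  simp only [Curve.isEndpt_iff_exists_endSegAt]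
  constructor
  · rintro ⟨S, hS⟩
    obtain ⟨r', u, e, hr, -⟩ := exists_endSegAt_of_isSubst hA hB hP hd hp h hS
    rw [hA.smul_inj] at e
    exact ⟨_, e ▸ hr⟩
  · rintro ⟨S, hS⟩
    obtain ⟨hSd, hrS, -⟩ := (hB.1 d hd).endSegAt_iff.1 hS
    obtain ⟨u, rfl⟩ := Sym2.mem_iff_exists.1 hrS
    obtain ⟨c, hc, h₁, h₂⟩ := hA.exists_isEndpt (mem_segs_traceOf_singleton.2 hSd)
    obtain ⟨U, hU⟩ := Curve.isEndpt_iff_exists_endSegAt.1 h₁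
    exact ⟨U, endSegAt_of_isSubst hA hB hP hd hp h hS hc h₂ hU⟩

end Convolution

/-- associativity of the convolution product:
`(𝒜 ∗ ℬ) ∗ 𝒞 = 𝒜 ∗ (ℬ ∗ 𝒞)`. -/
theorem statement2 {n : ℕ} (hn : 2 ≤ n) (A B C : Set (Curve n)) (i j k l : ℕ)
    (hA : SatH A i j) (hB : SatH B k l) (hC : DisjSA C)
    (P Q : Set (Curve n)) (hP : DisjSA P) (hPt : traceOf P = ConvTrace i A B)
    (hQ : DisjSA Q) (hQt : traceOf Q = ConvTrace k B C) :
    ConvTrace (i * k) P C = ConvTrace i A Q := by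
  have hBd := hB.disjSA
  have key (x : Pt n) : ((i * k : ℕ) : ℝ) • x = (i : ℝ) • (k : ℝ) • x := by
    rw [smul_smul, Nat.cast_mul]
  have ends {d p : Curve n} (hd : d ∈ B) (hp : p ∈ P) (h : IsSubst i A d p) (x : Pt n) :
      p.IsEndpt (((i * k : ℕ) : ℝ) • x) ↔ d.IsEndpt ((k : ℝ) • x) := by
    rw [key, isEndpt_iff_of_isSubst hA hBd hP hd hp h]
  have hsegs : (ConvTrace (i * k) P C).segs = (ConvTrace i A Q).segs := by
    ext S
    constructor
    · rintro ⟨a, b, hab, p, hp, ha, hb, hS⟩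
      obtain ⟨d, hd, h⟩ := exists_isSubst_left hA hBd hP hPt hp
      rw [ends hd hp h] at ha hb
      rw [h.1] at hS
      obtain ⟨a', b', hab', h'⟩ := hS
      refine ⟨a', b', ?_, h'⟩
      rw [hQt]
      exact ⟨a, b, hab, d, hd, ha, hb, mem_segs_traceOf_singleton.1 hab'⟩
    · rintro ⟨a', b', hab', h'⟩
      rw [hQt] at hab'
      obtain ⟨a, b, hab, d, hd, ha, hb, hS⟩ := hab'
      obtain ⟨p, hp, h⟩ := exists_isSubst_right hA hBd hP hPt hd
      rw [← ends hd hp h] at ha hb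
      refine ⟨a, b, hab, p, hp, ha, hb, ?_⟩
      rw [h.1]
      exact ⟨a', b', mem_segs_traceOf_singleton.2 hS, h'⟩
  have hconn : (ConvTrace (i * k) P C).conn = (ConvTrace i A Q).conn := by
    ext S T
    constructor
    · intro hST
      rcases convTrace_conn_cases hST with
        ⟨a, b, hab, p, hp, ha, hb, hS⟩ | ⟨a, b, e, hab, p, hp, p', hp', h₁, h₂, h₃, h₄⟩
      · obtain ⟨d, hd, h⟩ := exists_isSubst_left hA hBd hP hPt hp
        rw [ends hd hp h] at ha hb
        rw [h.2] at hS
        rcases convTrace_conn_cases hS with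
          ⟨a', b', hab', h'⟩ | ⟨a', b', e', h', c, hc, c', hc', h₁, h₂, h₃, h₄⟩
        · refine .inl ⟨a', b', ?_, h'⟩
          rw [hQt]
          exact ⟨a, b, hab, d, hd, ha, hb, mem_segs_traceOf_singleton.1 hab'⟩
        · refine convTrace_conn_of_endSegAt ?_ hc hc' h₁ h₂ h₃ h₄
          rw [hQt]
          exact .inl ⟨a, b, hab, d, hd, ha, hb, conn_traceOf_singleton.1 h'⟩
      · obtain ⟨d, hd, h⟩ := exists_isSubst_left hA hBd hP hPt hp
        obtain ⟨d', hd', h'⟩ := exists_isSubst_left hA hBd hP hPt hp'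
        rw [ends hd hp h] at h₁
        rw [ends hd' hp' h'] at h₂
        rw [key] at h₃ h₄
        obtain ⟨r, u, e₁, hr, c, hc, hu, hS⟩ :=
          exists_endSegAt_of_isSubst hA hBd hP hd hp h h₃
        obtain ⟨r', u', e₂, hr', c', hc', hu', hS'⟩ :=
          exists_endSegAt_of_isSubst hA hBd hP hd' hp' h' h₄
        rw [hA.smul_inj] at e₁ e₂
        subst e₁ e₂
        refine convTrace_conn_of_endSegAt ?_ hc hc' hu hu' hS hS'
        rw [hQt]
        exact convTrace_conn_of_endSegAt hab hd hd' h₁ h₂ hr hr'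
    · intro hST
      rcases convTrace_conn_cases hST with
        ⟨a', b', hab', h'⟩ | ⟨a', b', e', hab', c, hc, c', hc', h₁, h₂, h₃, h₄⟩
      · rw [hQt] at hab'
        obtain ⟨a, b, hab, d, hd, ha, hb, hS⟩ := hab'
        obtain ⟨p, hp, h⟩ := exists_isSubst_right hA hBd hP hPt hd
        rw [← ends hd hp h] at ha hb
        refine .inl ⟨a, b, hab, p, hp, ha, hb, ?_⟩
        rw [h.2]
        exact .inl ⟨a', b', mem_segs_traceOf_singleton.2 hS, h'⟩
      · have hne : s(b', a') ≠ s(b', e') := by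
          obtain ⟨q, -, hq⟩ := hab'
          exact Curve.conn_ne hq
        rw [hQt] at hab'
        rcases convTrace_conn_cases hab' with
          ⟨a, b, hab, d, hd, ha, hb, hS⟩ | ⟨a, b, e, hab, d, hd, d', hd', h₁', h₂', h₃', h₄'⟩
        · obtain ⟨p, hp, h⟩ := exists_isSubst_right hA hBd hP hPt hd
          rw [← ends hd hp h] at ha hb
          refine .inl ⟨a, b, hab, p, hp, ha, hb, ?_⟩
          rw [h.2]
          exact convTrace_conn_of_endSegAt (conn_traceOf_singleton.2 hS) hc hc' h₁ h₂ h₃ h₄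
        · obtain ⟨p, hp, h⟩ := exists_isSubst_right hA hBd hP hPt hd
          obtain ⟨p', hp', h'⟩ := exists_isSubst_right hA hBd hP hPt hd'
          rw [← ends hd hp h] at h₁'
          rw [← ends hd' hp' h'] at h₂'
          have hkb : (k : ℝ) • b = b' := by
            have m₁ := ((hBd.1 d hd).endSegAt_iff.1 h₃').2.1
            have m₂ := ((hBd.1 d' hd').endSegAt_iff.1 h₄').2.1
            rw [Sym2.mem_iff] at m₁ m₂
            by_contra hb
            exact hne (by rw [← m₁.resolve_left hb, ← m₂.resolve_left hb])
          subst hkb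
          refine convTrace_conn_of_endSegAt hab hp hp' h₁' h₂' ?_ ?_
          · rw [key]
            exact endSegAt_of_isSubst hA hBd hP hd hp h h₃' hc h₁ h₃
          · rw [key]
            exact endSegAt_of_isSubst hA hBd hP hd' hp' h' h₄' hc' h₂ h₄
  calc ConvTrace (i * k) P C
      = ⟨(ConvTrace (i * k) P C).segs, (ConvTrace (i * k) P C).conn⟩ := rfl
    _ = ConvTrace i A Q := by rw [hsegs, hconn]

end
end Folding
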